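/- arXiv:math/0506459 — 4 statements merged into one kernel-verified Lean document; each statement's English description precedes it below -/
import Mathlib

section
/- Let D ⊆ ℝⁿ be a domain containing the origin and f : ℝ × D → ℝⁿ satisfy: f(t,0)=0 for all t; f is uniformly continuous in t uniformly in x ∈ D; f is uniformly locally Lipschitz in x with a Lipschitz constant on each compact K ⊆ D independent of t; and ‖f(t,x)‖ ≤ M(x) for all t, for some continuous M : D → ℝ. Suppose there is a C¹ function V : D → ℝ with V(x) ≥ 0 on D and V(0) = 0, a continuous function W : D → ℝ with ∇V(x)·f(t,x) ≤ W(x) ≤ 0 for all (t,x), and suppose f restricted to E = {x ∈ D : W(x) = 0} is time-invariant (f(t,x) = f(t₀,x) for all t, t₀ and all x ∈ E). Let N be the maximal positively invariant set of the dynamics ẋ = f(t,x) contained in E. Then the origin is a uniformly asymptotically stable equilibrium of ẋ = f(t,x) if and only if the origin is an asymptotically stable equilibrium of the dynamics restricted to N. -/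
open Set Filter Metric Topology

/-- `x` solves the time-varying ODE `ẋ = f t x`, staying in the set `D`,
for every time in the time set `s`. -/
def IsSolOn {n : ℕ} (D : Set (EuclideanSpace ℝ (Fin n)))
    (f : ℝ → EuclideanSpace ℝ (Fin n) → EuclideanSpace ℝ (Fin n))
    (x : ℝ → EuclideanSpace ℝ (Fin n)) (s : Set ℝ) : Prop :=
  ∀ t ∈ s, x t ∈ D ∧ HasDerivAt x (f t (x t)) t

/-- `S` is positively invariant for the dynamics `ẋ = f t x` on `D`:
every solution (lying in `D`) starting in `S` stays in `S`. -/
def PosInvariant {n : ℕ} (D : Set (EuclideanSpace ℝ (Fin n)))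
    (f : ℝ → EuclideanSpace ℝ (Fin n) → EuclideanSpace ℝ (Fin n))
    (S : Set (EuclideanSpace ℝ (Fin n))) : Prop :=
  ∀ (t₀ t₁ : ℝ) (x : ℝ → EuclideanSpace ℝ (Fin n)),
    IsSolOn D f x (Icc t₀ t₁) → x t₀ ∈ S → ∀ t ∈ Icc t₀ t₁, x t ∈ S

/-- The maximal positively invariant subset of `E` for the dynamics `ẋ = f t x` on `D`. -/
def MaxPosInv {n : ℕ} (D : Set (EuclideanSpace ℝ (Fin n)))
    (f : ℝ → EuclideanSpace ℝ (Fin n) → EuclideanSpace ℝ (Fin n))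
    (E : Set (EuclideanSpace ℝ (Fin n))) : Set (EuclideanSpace ℝ (Fin n)) :=
  ⋃₀ {S | S ⊆ E ∧ PosInvariant D f S}

/-- The origin is a uniformly stable equilibrium of `ẋ = f t x` on `D`. -/
def UniformlyStable {n : ℕ} (D : Set (EuclideanSpace ℝ (Fin n)))
    (f : ℝ → EuclideanSpace ℝ (Fin n) → EuclideanSpace ℝ (Fin n)) : Prop :=
  ∀ ε > 0, ∃ δ > 0, ∀ t₀ : ℝ, ∀ x₀ ∈ D, ‖x₀‖ < δ →
    ∃ x : ℝ → EuclideanSpace ℝ (Fin n), x t₀ = x₀ ∧ IsSolOn D f x (Ici t₀) ∧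
      ∀ t > t₀, ‖x t‖ < ε

/-- The origin is a uniformly asymptotically stable equilibrium of `ẋ = f t x` on `D`. -/
def UniformlyAsympStable {n : ℕ} (D : Set (EuclideanSpace ℝ (Fin n)))
    (f : ℝ → EuclideanSpace ℝ (Fin n) → EuclideanSpace ℝ (Fin n)) : Prop :=
  UniformlyStable D f ∧ ∃ δ > 0, ∀ t₀ : ℝ, ∀ x₀ ∈ D, ‖x₀‖ < δ →
    ∃ x : ℝ → EuclideanSpace ℝ (Fin n), x t₀ = x₀ ∧ IsSolOn D f x (Ici t₀) ∧
      Tendsto x atTop (𝓝 0)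

/-- The origin is a (possibly non-uniformly) stable equilibrium of the dynamics
`ẋ = f t x` restricted to the set `N`. -/
def StableOn {n : ℕ} (N : Set (EuclideanSpace ℝ (Fin n)))
    (f : ℝ → EuclideanSpace ℝ (Fin n) → EuclideanSpace ℝ (Fin n)) : Prop :=
  ∀ t₀ : ℝ, ∀ ε > 0, ∃ δ > 0, ∀ x₀ ∈ N, ‖x₀‖ < δ →
    ∃ x : ℝ → EuclideanSpace ℝ (Fin n), x t₀ = x₀ ∧ IsSolOn N f x (Ici t₀) ∧
      ∀ t > t₀, ‖x t‖ < ε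

/-- The origin is an asymptotically stable equilibrium of the dynamics
`ẋ = f t x` restricted to the set `N`. -/
def AsympStableOn {n : ℕ} (N : Set (EuclideanSpace ℝ (Fin n)))
    (f : ℝ → EuclideanSpace ℝ (Fin n) → EuclideanSpace ℝ (Fin n)) : Prop :=
  StableOn N f ∧ ∀ t₀ : ℝ, ∃ δ > 0, ∀ x₀ ∈ N, ‖x₀‖ < δ →
    ∃ x : ℝ → EuclideanSpace ℝ (Fin n), x t₀ = x₀ ∧ IsSolOn N f x (Ici t₀) ∧
      Tendsto x atTop (𝓝 0)

open scoped NNReal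

section Auxiliary

variable {E : Type*} [NormedAddCommGroup E] [NormedSpace ℝ E]

/-- The radial retraction onto a closed ball is Lipschitz. -/
theorem exists_lipschitzWith_retraction_closedBall {R : ℝ} (hR : 0 < R) :
    ∃ ρ : E → E, LipschitzWith 2 ρ ∧ (∀ x, ‖ρ x‖ ≤ R) ∧ ∀ x, ‖x‖ ≤ R → ρ x = x := by
  have hm : ∀ x : E, 0 < max R ‖x‖ := fun x => lt_max_of_lt_left hR
  refine ⟨fun x => (R / max R ‖x‖) • x, LipschitzWith.of_dist_le_mul fun x y => ?_,
    fun x => ?_, fun x hx => ?_⟩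
  · have hx := hm x
    have hy := hm y
    have hsplit : (R / max R ‖x‖) • x - (R / max R ‖y‖) • y
        = (R / max R ‖x‖) • (x - y) + (R / max R ‖x‖ - R / max R ‖y‖) • y := by
      rw [smul_sub, sub_smul]; abel
    have h1 : R / max R ‖x‖ ≤ 1 := (div_le_one hx).2 (le_max_left _ _)
    have h1' : 0 ≤ R / max R ‖x‖ := by positivity
    have h2 : ‖y‖ / max R ‖y‖ ≤ 1 := (div_le_one hy).2 (le_max_right _ _)
    have h2' : 0 ≤ ‖y‖ / max R ‖y‖ := by positivity
    have h3 : |max R ‖y‖ - max R ‖x‖| ≤ ‖x - y‖ := by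
      have := abs_max_sub_max_le_max R ‖y‖ R ‖x‖
      have h4 := abs_norm_sub_norm_le y x
      rw [norm_sub_rev] at h4
      simpa using this.trans (by simpa using h4)
    have h5 : |R / max R ‖x‖ - R / max R ‖y‖| * ‖y‖
        = (R / max R ‖x‖) * (‖y‖ / max R ‖y‖) * |max R ‖y‖ - max R ‖x‖| := by
      have : R / max R ‖x‖ - R / max R ‖y‖
          = (R / max R ‖x‖) * (1 / max R ‖y‖) * (max R ‖y‖ - max R ‖x‖) := by
        field_simp
      rw [this, abs_mul, abs_of_nonneg (by positivity)]
      ring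
    have h6 : (R / max R ‖x‖) * (‖y‖ / max R ‖y‖) * |max R ‖y‖ - max R ‖x‖| ≤ ‖x - y‖ := by
      calc _ ≤ 1 * |max R ‖y‖ - max R ‖x‖| := by
            gcongr
            exact mul_le_one₀ h1 h2' h2
        _ ≤ _ := by simpa using h3
    rw [dist_eq_norm, dist_eq_norm, hsplit]
    refine (norm_add_le _ _).trans ?_
    rw [norm_smul, norm_smul, Real.norm_eq_abs, Real.norm_eq_abs, abs_of_nonneg h1', h5]
    have h7 : R / max R ‖x‖ * ‖x - y‖ ≤ ‖x - y‖ :=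
      mul_le_of_le_one_left (norm_nonneg _) h1
    have : ((2 : ℝ≥0) : ℝ) = 2 := rfl
    rw [this]
    linarith
  · have hx := hm x
    rw [norm_smul, Real.norm_eq_abs, abs_of_nonneg (by positivity), div_mul_eq_mul_div,
      div_le_iff₀ hx]
    gcongr
    exact le_max_right _ _
  · simp [max_eq_left hx, hR.ne']

/-- A bounded time-varying vector field, uniformly Lipschitz in space and continuous in time,
has global integral curves. -/
theorem exists_global_solution [CompleteSpace E] {g : ℝ → E → E} {L : ℝ≥0} {B : ℝ}
    (hL : ∀ t, LipschitzWith L (g t)) (hB : ∀ t x, ‖g t x‖ ≤ B)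
    (hc : ∀ x, Continuous fun t => g t x) (t₀ : ℝ) (x₀ : E) :
    ∃ x : ℝ → E, x t₀ = x₀ ∧ ∀ t, HasDerivAt x (g t (x t)) t := by
  have hB0 : 0 ≤ B := (norm_nonneg _).trans (hB 0 0)
  have hloc : ∀ k : ℕ, ∃ α : ℝ → E, α t₀ = x₀ ∧
      ∀ t ∈ Ioo (t₀ - (k + 1)) (t₀ + (k + 1)), HasDerivAt α (g t (α t)) t := by
    intro k
    have hk : (0 : ℝ) ≤ k := k.cast_nonneg
    have hPL : IsPicardLindelof g (tmin := t₀ - (k + 1)) (tmax := t₀ + (k + 1))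
        ⟨t₀, by constructor <;> linarith⟩ x₀ (B.toNNReal * (k + 1)) 0 B.toNNReal L :=
      { lipschitzOnWith := fun t _ => (hL t).lipschitzOnWith
        continuousOn := fun x _ => (hc x).continuousOn
        norm_le := fun t _ x _ => (hB t x).trans (Real.le_coe_toNNReal B)
        mul_max_le := by simp }
    obtain ⟨α, h0, hα⟩ := hPL.exists_eq_forall_mem_Icc_hasDerivWithinAt₀
    exact ⟨α, h0, fun t ht =>
      (hα t (Ioo_subset_Icc_self ht)).hasDerivAt (Icc_mem_nhds ht.1 ht.2)⟩
  choose α hα0 hα using hloc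
  have hagree : ∀ k m : ℕ, k ≤ m → ∀ t ∈ Ioo (t₀ - (k + 1)) (t₀ + (k + 1)),
      α k t = α m t := by
    intro k m hkm
    have hk : (0 : ℝ) ≤ k := k.cast_nonneg
    have hkm' : (k : ℝ) ≤ m := by exact_mod_cast hkm
    refine ODE_solution_unique_of_mem_Ioo (v := g) (s := fun _ => univ) (K := L) (t₀ := t₀)
      (fun t _ => (hL t).lipschitzOnWith) (by constructor <;> linarith)
      (fun t ht => ⟨hα k t ht, trivial⟩)
      (fun t ht => ⟨hα m t ⟨by linarith [ht.1], by linarith [ht.2]⟩, trivial⟩)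
      (by rw [hα0, hα0])
  have hmem : ∀ t, t ∈ Ioo (t₀ - ((⌊|t - t₀|⌋₊ : ℝ) + 1)) (t₀ + ((⌊|t - t₀|⌋₊ : ℝ) + 1)) := by
    intro t
    have := abs_lt.1 (Nat.lt_floor_add_one |t - t₀|)
    constructor <;> linarith [this.1, this.2]
  have hx : ∀ (k : ℕ), ∀ t ∈ Ioo (t₀ - ((k : ℝ) + 1)) (t₀ + (k + 1)),
      α ⌊|t - t₀|⌋₊ t = α k t := by
    intro k t ht
    rcases le_total ⌊|t - t₀|⌋₊ k with h | h
    · exact hagree _ _ h t (hmem t)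
    · exact (hagree _ _ h t ht).symm
  refine ⟨fun t => α ⌊|t - t₀|⌋₊ t, hα0 _, fun t => ?_⟩
  refine (hα ⌊|t - t₀|⌋₊ t (hmem t)).congr_of_eventuallyEq ?_
  filter_upwards [Ioo_mem_nhds (hmem t).1 (hmem t).2] with s hs using hx _ s hs

theorem dist_le_gronwallBound_of_approx_solution {v : ℝ → E → E} {s : Set E} {L : ℝ≥0}
    {x x' y : ℝ → E} {a b δ ε : ℝ} (hv : ∀ t, LipschitzOnWith L (v t) s)
    (hx : ∀ t ∈ Icc a b, HasDerivAt x (x' t) t) (hxs : ∀ t ∈ Icc a b, x t ∈ s)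
    (hx' : ∀ t ∈ Icc a b, dist (x' t) (v t (x t)) ≤ ε)
    (hy : ∀ t ∈ Icc a b, HasDerivAt y (v t (y t)) t) (hys : ∀ t ∈ Icc a b, y t ∈ s)
    (h0 : dist (x a) (y a) ≤ δ) :
    ∀ t ∈ Icc a b, dist (x t) (y t) ≤ gronwallBound δ L ε (t - a) := by
  have h := dist_le_of_approx_trajectories_ODE_of_mem (v := v) (s := fun _ => s) (K := L)
    (f := x) (g := y) (f' := x') (g' := fun t => v t (y t)) (a := a) (b := b)
    (εf := ε) (εg := 0) (δ := δ) (fun t _ => hv t)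
    (fun t ht => (hx t ht).continuousAt.continuousWithinAt)
    (fun t ht => (hx t (Ico_subset_Icc_self ht)).hasDerivWithinAt)
    (fun t ht => hx' t (Ico_subset_Icc_self ht)) (fun t ht => hxs t (Ico_subset_Icc_self ht))
    (fun t ht => (hy t ht).continuousAt.continuousWithinAt)
    (fun t ht => (hy t (Ico_subset_Icc_self ht)).hasDerivWithinAt)
    (fun t _ => (dist_self _).le) (fun t ht => hys t (Ico_subset_Icc_self ht)) h0
  simpa using h

theorem exists_gronwallBound_lt (L h : ℝ) {ε : ℝ} (hε : 0 < ε) :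
    ∃ δ > 0, gronwallBound δ L δ h < ε := by
  have hcont : Continuous fun δ : ℝ => gronwallBound δ L δ h := by
    unfold gronwallBound
    split_ifs <;> fun_prop
  have hlt : ∀ᶠ δ in 𝓝 (0 : ℝ), gronwallBound δ L δ h < ε :=
    hcont.continuousAt.eventually_lt continuousAt_const
      (by simpa [gronwallBound_ε0_δ0] using hε)
  obtain ⟨δ, hδ, hpos⟩ :=
    ((hlt.filter_mono nhdsWithin_le_nhds).and (self_mem_nhdsWithin (s := Ioi (0 : ℝ)))).exists
  exact ⟨δ, hpos, hδ⟩

end Auxiliary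

section Dynamics

variable {n : ℕ} {D : Set (EuclideanSpace ℝ (Fin n))}
  {f : ℝ → EuclideanSpace ℝ (Fin n) → EuclideanSpace ℝ (Fin n)}

theorem IsSolOn.mono {D' : Set (EuclideanSpace ℝ (Fin n))} {x : ℝ → EuclideanSpace ℝ (Fin n)}
    {s s' : Set ℝ} (hx : IsSolOn D f x s) (hD : D ⊆ D') (hs : s' ⊆ s) : IsSolOn D' f x s' :=
  fun t ht => ⟨hD (hx t (hs ht)).1, (hx t (hs ht)).2⟩

theorem IsSolOn.continuousOn {x : ℝ → EuclideanSpace ℝ (Fin n)} {s : Set ℝ}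
    (hx : IsSolOn D f x s) : ContinuousOn x s :=
  fun t ht => (hx t ht).2.continuousAt.continuousWithinAt

theorem maxPosInv_subset {S : Set (EuclideanSpace ℝ (Fin n))} : MaxPosInv D f S ⊆ S :=
  sUnion_subset fun _ h => h.1

theorem posInvariant_maxPosInv {S : Set (EuclideanSpace ℝ (Fin n))} :
    PosInvariant D f (MaxPosInv D f S) := by
  rintro t₀ t₁ x hx ⟨A, hA, hxA⟩ t ht
  exact ⟨A, hA, hA.2 t₀ t₁ x hx hxA t ht⟩

theorem PosInvariant.isSolOn_Ici {S : Set (EuclideanSpace ℝ (Fin n))} (hS : PosInvariant D f S)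
    {x : ℝ → EuclideanSpace ℝ (Fin n)} {t₀ : ℝ} (hx : IsSolOn D f x (Ici t₀)) (h0 : x t₀ ∈ S) :
    IsSolOn S f x (Ici t₀) :=
  fun t ht => ⟨hS t₀ t x (hx.mono subset_rfl Icc_subset_Ici_self) h0 t ⟨ht, le_rfl⟩, (hx t ht).2⟩

theorem IsSolOn.eqOn_Ici
    (hlip : ∀ K ⊆ D, IsCompact K → ∃ L : ℝ≥0, ∀ t, LipschitzOnWith L (f t) K)
    {x y : ℝ → EuclideanSpace ℝ (Fin n)} {t₀ : ℝ} (hx : IsSolOn D f x (Ici t₀))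
    (hy : IsSolOn D f y (Ici t₀)) (h0 : x t₀ = y t₀) : EqOn x y (Ici t₀) := by
  intro t ht
  have hxI : IsSolOn D f x (Icc t₀ t) := hx.mono subset_rfl Icc_subset_Ici_self
  have hyI : IsSolOn D f y (Icc t₀ t) := hy.mono subset_rfl Icc_subset_Ici_self
  obtain ⟨L, hL⟩ := hlip (x '' Icc t₀ t ∪ y '' Icc t₀ t)
    (union_subset (image_subset_iff.2 fun s hs => (hxI s hs).1)
      (image_subset_iff.2 fun s hs => (hyI s hs).1))
    ((isCompact_Icc.image_of_continuousOn hxI.continuousOn).union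
      (isCompact_Icc.image_of_continuousOn hyI.continuousOn))
  have h := dist_le_gronwallBound_of_approx_solution (ε := 0) (δ := 0) hL
    (fun s hs => (hxI s hs).2) (fun s hs => Or.inl (mem_image_of_mem _ hs))
    (fun s _ => (dist_self _).le)
    (fun s hs => (hyI s hs).2) (fun s hs => Or.inr (mem_image_of_mem _ hs))
    (by rw [h0, dist_self]) t ⟨ht, le_rfl⟩
  rw [gronwallBound_ε0_δ0] at h
  exact dist_le_zero.1 h

theorem UniformlyAsympStable.asympStableOn {S : Set (EuclideanSpace ℝ (Fin n))} (hSD : S ⊆ D)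
    (hS : PosInvariant D f S) (h : UniformlyAsympStable D f) : AsympStableOn S f := by
  obtain ⟨hst, δ, hδ, hatt⟩ := h
  refine ⟨fun t₀ ε hε => ?_, fun t₀ => ⟨δ, hδ, fun x₀ hx₀ hn => ?_⟩⟩
  · obtain ⟨δ', hδ', h'⟩ := hst ε hε
    refine ⟨δ', hδ', fun x₀ hx₀ hn => ?_⟩
    obtain ⟨x, h0, hx, hlt⟩ := h' t₀ x₀ (hSD hx₀) hn
    exact ⟨x, h0, hS.isSolOn_Ici hx (h0 ▸ hx₀), hlt⟩
  · obtain ⟨x, h0, hx, hlim⟩ := hatt t₀ x₀ (hSD hx₀) hn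
    exact ⟨x, h0, hS.isSolOn_Ici hx (h0 ▸ hx₀), hlim⟩

/-- The vector field agrees on a closed ball contained in `D` with a globally Lipschitz one all of
whose integral curves are global. -/
theorem exists_global_modification {R : ℝ} (hR : 0 < R)
    (hRD : closedBall (0 : EuclideanSpace ℝ (Fin n)) R ⊆ D)
    (hlip : ∀ K ⊆ D, IsCompact K → ∃ L : ℝ≥0, ∀ t, LipschitzOnWith L (f t) K)
    (hcont : ∀ x ∈ D, Continuous fun t => f t x)
    (hbdd : ∀ K ⊆ D, IsCompact K → ∃ B : ℝ, ∀ t, ∀ x ∈ K, ‖f t x‖ ≤ B) :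
    ∃ (L : ℝ≥0) (g : ℝ → EuclideanSpace ℝ (Fin n) → EuclideanSpace ℝ (Fin n)),
      (∀ t, LipschitzWith L (g t)) ∧ (∀ t x, ‖x‖ ≤ R → g t x = f t x) ∧
      ∀ t₀ x₀, ∃ x : ℝ → EuclideanSpace ℝ (Fin n), x t₀ = x₀ ∧
        ∀ t, HasDerivAt x (g t (x t)) t := by
  obtain ⟨ρ, hρL, hρR, hρ⟩ :=
    exists_lipschitzWith_retraction_closedBall (E := EuclideanSpace ℝ (Fin n)) hR
  have hmem : ∀ x, ρ x ∈ closedBall (0 : EuclideanSpace ℝ (Fin n)) R := fun x => by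
    simpa using hρR x
  obtain ⟨L, hL⟩ := hlip _ hRD (isCompact_closedBall _ _)
  obtain ⟨B, hB⟩ := hbdd _ hRD (isCompact_closedBall _ _)
  have hgL : ∀ t, LipschitzWith (L * 2) fun x => f t (ρ x) := fun t =>
    lipschitzOnWith_univ.1
      ((hL t).comp hρL.lipschitzOnWith fun x _ => hmem x)
  refine ⟨L * 2, fun t x => f t (ρ x), hgL, fun t x hx => by simp only [hρ x hx],
    exists_global_solution hgL (fun t x => hB t _ (hmem x)) fun x => hcont _ (hRD (hmem x))⟩

theorem IsSolOn.lyapunov_le (hDopen : IsOpen D) {V : EuclideanSpace ℝ (Fin n) → ℝ}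
    (hV : ContDiffOn ℝ 1 V D) {x : ℝ → EuclideanSpace ℝ (Fin n)} {a b c : ℝ} (hab : a ≤ b)
    (hx : IsSolOn D f x (Icc a b))
    (hc : ∀ t ∈ Icc a b, fderiv ℝ V (x t) (f t (x t)) ≤ c) :
    V (x b) ≤ V (x a) + c * (b - a) := by
  have hd : ∀ t ∈ Icc a b, HasDerivAt (fun s => V (x s)) (fderiv ℝ V (x t) (f t (x t))) t := by
    intro t ht
    have hVd : DifferentiableAt ℝ V (x t) :=
      (hV.differentiableOn one_ne_zero).differentiableAt (hDopen.mem_nhds (hx t ht).1)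
    exact hVd.hasFDerivAt.comp_hasDerivAt t (hx t ht).2
  have h := (convex_Icc a b).image_sub_le_mul_sub_of_deriv_le (f := fun s => V (x s)) (C := c)
    (fun t ht => (hd t ht).continuousAt.continuousWithinAt)
    (fun t ht => (hd t (interior_subset ht)).differentiableAt.differentiableWithinAt)
    (fun t ht => by
      rw [(hd t (interior_subset ht)).deriv]
      exact hc t (interior_subset ht))
    a ⟨le_rfl, hab⟩ b ⟨hab, le_rfl⟩ hab
  linarith

variable {V W : EuclideanSpace ℝ (Fin n) → ℝ}

/-- The zero set of the Lyapunov function lies in the maximal positively invariant set. -/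
theorem mem_maxPosInv_of_lyapunov_eq_zero (hDopen : IsOpen D) (hV : ContDiffOn ℝ 1 V D)
    (hVnonneg : ∀ x ∈ D, 0 ≤ V x) (hVW : ∀ t : ℝ, ∀ x ∈ D, fderiv ℝ V x (f t x) ≤ W x)
    (hWnonpos : ∀ x ∈ D, W x ≤ 0) {z : EuclideanSpace ℝ (Fin n)} (hz : z ∈ D) (hVz : V z = 0) :
    z ∈ MaxPosInv D f {y ∈ D | W y = 0} := by
  refine ⟨{y ∈ D | V y = 0}, ⟨fun y hy => ⟨hy.1, ?_⟩, ?_⟩, hz, hVz⟩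
  · have hmin : IsLocalMin V y := by
      filter_upwards [hDopen.mem_nhds hy.1] with w hw
      rw [hy.2]
      exact hVnonneg w hw
    have := hVW 0 y hy.1
    rw [hmin.fderiv_eq_zero] at this
    exact le_antisymm (hWnonpos y hy.1) (by simpa using this)
  · intro t₀ t₁ x hx h0 t ht
    have hsub : Icc t₀ t ⊆ Icc t₀ t₁ := Icc_subset_Icc_right ht.2
    have := (hx.mono subset_rfl hsub).lyapunov_le hDopen hV (c := 0) ht.1 fun s hs =>
      (hVW s _ (hx s (hsub hs)).1).trans (hWnonpos _ (hx s (hsub hs)).1)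
    have hVx : V (x t₀) = 0 := h0.2
    exact ⟨(hx t ht).1, le_antisymm (by linarith) (hVnonneg _ (hx t ht).1)⟩

theorem uniformlyStable_of_asympStableOn_maxPosInv (hDopen : IsOpen D)
    (h0D : (0 : EuclideanSpace ℝ (Fin n)) ∈ D)
    (hlip : ∀ K ⊆ D, IsCompact K → ∃ L : ℝ≥0, ∀ t, LipschitzOnWith L (f t) K)
    (hcont : ∀ x ∈ D, Continuous fun t => f t x)
    (hbdd : ∀ K ⊆ D, IsCompact K → ∃ B : ℝ, ∀ t, ∀ x ∈ K, ‖f t x‖ ≤ B)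
    (hV : ContDiffOn ℝ 1 V D) (hVnonneg : ∀ x ∈ D, 0 ≤ V x) (hV0 : V 0 = 0)
    (hVW : ∀ t : ℝ, ∀ x ∈ D, fderiv ℝ V x (f t x) ≤ W x) (hWnonpos : ∀ x ∈ D, W x ≤ 0)
    (htinv : ∀ t t₀ : ℝ, ∀ x ∈ {y ∈ D | W y = 0}, f t x = f t₀ x)
    (hN : AsympStableOn (MaxPosInv D f {y ∈ D | W y = 0}) f) : UniformlyStable D f := by
  intro ε hε
  have hND : MaxPosInv D f {y ∈ D | W y = 0} ⊆ D := maxPosInv_subset.trans fun _ h => h.1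
  obtain ⟨R, hR, hRD⟩ := nhds_basis_closedBall.mem_iff.1 (hDopen.mem_nhds h0D)
  obtain ⟨L, g, hgL, hgf, hgsol⟩ := exists_global_modification hR hRD hlip hcont hbdd
  obtain ⟨r, hr, hrε, hrR⟩ : ∃ r > 0, r ≤ ε ∧ r ≤ R :=
    ⟨min ε R, lt_min hε hR, min_le_left _ _, min_le_right _ _⟩
  have hballD : ∀ x : EuclideanSpace ℝ (Fin n), ‖x‖ ≤ R → x ∈ D := fun x hx =>
    hRD (by simpa using hx)
  obtain ⟨δ₁, hδ₁, hstab⟩ := hN.1 0 (r / 2) (by positivity)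
  obtain ⟨δ₂, hδ₂, hatt⟩ := hN.2 0
  obtain ⟨η, hη, hη₁, hη₂, hηr⟩ : ∃ η > 0, η < δ₁ ∧ η < δ₂ ∧ η < r / 2 := by
    obtain ⟨η, h0, h⟩ := exists_between (lt_min (lt_min hδ₁ hδ₂) (half_pos hr))
    simp only [lt_min_iff] at h
    exact ⟨η, h0, h.1.1, h.1.2, h.2⟩
  -- Near each zero of `V` the flow returns to the ball of radius `η` without leaving the `r`-ball.
  have hreturn : ∀ z, ‖z‖ ≤ η ∧ V z = 0 → ∃ T : ℝ, 1 ≤ T ∧ ∃ d > 0, ∀ (t₀ : ℝ)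
      (x : ℝ → EuclideanSpace ℝ (Fin n)), (∀ t, HasDerivAt x (g t (x t)) t) →
      dist (x t₀) z < d → (∀ t ∈ Icc t₀ (t₀ + T), ‖x t‖ < r) ∧ ‖x (t₀ + T)‖ < η := by
    rintro z ⟨hz, hVz⟩
    have hzN := mem_maxPosInv_of_lyapunov_eq_zero (f := f) hDopen hV hVnonneg hVW hWnonpos
      (hballD z (by linarith)) hVz
    obtain ⟨φ, hφ0, hφ, hφr⟩ := hstab z hzN (by linarith)
    obtain ⟨ψ, hψ0, hψ, hψlim⟩ := hatt z hzN (by linarith)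
    have hEq : EqOn φ ψ (Ici 0) := (hφ.mono hND subset_rfl).eqOn_Ici hlip
      (hψ.mono hND subset_rfl) (hφ0.trans hψ0.symm)
    obtain ⟨T, hT, hT1⟩ := ((hψlim.norm.eventually_lt_const
      (show ‖(0 : EuclideanSpace ℝ (Fin n))‖ < η / 2 by simpa using half_pos hη)).and
      (eventually_ge_atTop (1 : ℝ))).exists
    rw [← hEq (show (0 : ℝ) ≤ T by linarith)] at hT
    have hφr' : ∀ t, 0 ≤ t → ‖φ t‖ < r / 2 := by
      intro t ht
      rcases ht.eq_or_lt with rfl | ht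
      · rw [hφ0]; linarith
      · exact hφr t ht
    refine ⟨T, hT1, η / 2 * Real.exp (-(L * T)), by positivity, fun t₀ x hx hd => ?_⟩
    have hφ' : ∀ t ∈ Icc t₀ (t₀ + T),
        HasDerivAt (fun s => φ (s - t₀)) (g t (φ (t - t₀))) t := by
      intro t ht
      have h0 : 0 ≤ t - t₀ := sub_nonneg.2 ht.1
      have hmem := hφ (t - t₀) h0
      rw [hgf t _ (by linarith [hφr' _ h0]), htinv t (t - t₀) _ (maxPosInv_subset hmem.1)]
      exact hmem.2.comp_sub_const t t₀
    have hclose : ∀ t ∈ Icc t₀ (t₀ + T), dist (x t) (φ (t - t₀)) ≤ η / 2 := by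
      intro t ht
      have h := dist_le_gronwallBound_of_approx_solution (ε := 0) (s := univ)
        (fun t => (hgL t).lipschitzOnWith) (fun s _ => hx s) (fun _ _ => trivial)
        (fun s _ => (dist_self _).le) hφ' (fun _ _ => trivial)
        (by simpa [hφ0] using hd.le) t ht
      rw [gronwallBound_ε0, mul_assoc, ← Real.exp_add] at h
      refine h.trans (mul_le_of_le_one_right (by positivity) (Real.exp_le_one_iff.2 ?_))
      have : (L : ℝ) * (t - t₀) ≤ L * T := by gcongr; linarith [ht.2]
      linarith
    have htri : ∀ t, ‖x t‖ ≤ dist (x t) (φ (t - t₀)) + ‖φ (t - t₀)‖ := fun t => by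
      rw [dist_eq_norm]
      simpa using norm_add_le (x t - φ (t - t₀)) (φ (t - t₀))
    refine ⟨fun t ht => ?_, ?_⟩
    · linarith [htri t, hclose t ht, hφr' (t - t₀) (sub_nonneg.2 ht.1)]
    · have h1 := htri (t₀ + T)
      have h2 := hclose (t₀ + T) ⟨by linarith, le_rfl⟩
      rw [add_sub_cancel_left] at h1 h2
      linarith
  choose! T hT1 d hd hret using hreturn
  have hVc : ContinuousOn V D := hV.continuousOn
  -- A sublevel set of `V` in the `η`-ball is covered by these neighbourhoods.
  obtain ⟨c, hc, hcover⟩ : ∃ c > 0, ∀ x, ‖x‖ ≤ η → V x < c →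
      ∃ z, (‖z‖ ≤ η ∧ V z = 0) ∧ dist x z < d z := by
    set U : Set (EuclideanSpace ℝ (Fin n)) := ⋃ z ∈ {z | ‖z‖ ≤ η ∧ V z = 0}, ball z (d z) with hU
    have hUo : IsOpen U := isOpen_biUnion fun _ _ => isOpen_ball
    have hC : IsCompact (closedBall 0 η \ U) := (isCompact_closedBall _ _).diff hUo
    have hCD : closedBall 0 η \ U ⊆ D := fun x hx => hballD x (by
      have := hx.1
      rw [mem_closedBall_zero_iff] at this
      linarith)
    have hmemU : ∀ x, x ∈ U → ∃ z, (‖z‖ ≤ η ∧ V z = 0) ∧ dist x z < d z := by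
      intro x hx
      simpa only [hU, mem_iUnion, mem_ball, exists_prop, mem_ofPred_eq] using hx
    rcases (closedBall 0 η \ U).eq_empty_or_nonempty with hemp | hne
    · refine ⟨1, one_pos, fun x hx _ => hmemU x ?_⟩
      by_contra hxU
      exact (hemp ▸ (⟨by simpa using hx, hxU⟩ : x ∈ closedBall 0 η \ U) : x ∈ (∅ : Set _))
    · obtain ⟨m, hm, hmin⟩ := hC.exists_isMinOn hne (hVc.mono hCD)
      refine ⟨V m, (hVnonneg m (hCD hm)).lt_of_ne fun h => hm.2 ?_, fun x hx hlt => hmemU x ?_⟩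
      · have hmη : ‖m‖ ≤ η := by simpa using hm.1
        exact mem_biUnion (show m ∈ {z | ‖z‖ ≤ η ∧ V z = 0} from ⟨hmη, h.symm⟩)
          (mem_ball_self (hd m ⟨hmη, h.symm⟩))
      · by_contra hxU
        exact absurd (hmin (⟨by simpa using hx, hxU⟩ : x ∈ closedBall 0 η \ U)) (not_le.2 hlt)
  have hiter : ∀ (k : ℕ) (t₀ : ℝ) (x : ℝ → EuclideanSpace ℝ (Fin n)),
      (∀ t, HasDerivAt x (g t (x t)) t) → ‖x t₀‖ ≤ η → V (x t₀) < c →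
      ∀ t ∈ Icc t₀ (t₀ + k), ‖x t‖ < r := by
    intro k
    induction k with
    | zero =>
      intro t₀ x _ hx0 _ t ht
      obtain rfl : t = t₀ := le_antisymm (by simpa using ht.2) ht.1
      linarith
    | succ k ih =>
      intro t₀ x hx hx0 hVx t ht
      obtain ⟨z, hz, hdz⟩ := hcover _ hx0 hVx
      have hTz := hT1 z hz
      obtain ⟨hlt, hend⟩ := hret z hz t₀ x hx hdz
      rcases le_total t (t₀ + T z) with h | h
      · exact hlt t ⟨ht.1, h⟩
      · have hsol : IsSolOn D f x (Icc t₀ (t₀ + T z)) := fun s hs => by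
          have hsR : ‖x s‖ ≤ R := by linarith [hlt s hs]
          exact ⟨hballD _ hsR, hgf s _ hsR ▸ hx s⟩
        have hdec := hsol.lyapunov_le hDopen hV (c := 0) (by linarith) fun s hs =>
          (hVW s _ (hsol s hs).1).trans (hWnonpos _ (hsol s hs).1)
        refine ih (t₀ + T z) x hx hend.le (by linarith) t ⟨h, ?_⟩
        have := ht.2
        push_cast at this
        linarith
  obtain ⟨δ, hδ, hδV⟩ : ∃ δ > 0, ∀ x : EuclideanSpace ℝ (Fin n), ‖x‖ < δ → V x < c := by
    have : ∀ᶠ x in 𝓝 (0 : EuclideanSpace ℝ (Fin n)), V x < c :=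
      (hVc.continuousAt (hDopen.mem_nhds h0D)).eventually_lt continuousAt_const (by rwa [hV0])
    obtain ⟨δ, hδ, h⟩ := Metric.eventually_nhds_iff.1 this
    exact ⟨δ, hδ, fun x hx => h (by simpa using hx)⟩
  refine ⟨min δ η, lt_min hδ hη, fun t₀ x₀ _ hx₀ => ?_⟩
  obtain ⟨x, hx0, hx⟩ := hgsol t₀ x₀
  have hbound : ∀ t, t₀ ≤ t → ‖x t‖ < r := by
    intro t ht
    obtain ⟨k, hk⟩ := exists_nat_ge (t - t₀)
    refine hiter k t₀ x hx ?_ (hδV _ ?_) t ⟨ht, by linarith⟩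
    · rw [hx0]; exact (hx₀.trans_le (min_le_right _ _)).le
    · rw [hx0]; exact hx₀.trans_le (min_le_left _ _)
  refine ⟨x, hx0, fun t ht => ?_, fun t ht => (hbound t ht.le).trans_le hrε⟩
  have htR : ‖x t‖ ≤ R := (hbound t ht).le.trans hrR
  exact ⟨hballD _ htR, hgf t _ htR ▸ hx t⟩

/-- LaSalle's principle: cluster points of a solution remaining in a compact subset of `D` are
zeros of `W`. -/
theorem IsSolOn.eq_zero_of_mapClusterPt (hDopen : IsOpen D) (hV : ContDiffOn ℝ 1 V D)
    (hVnonneg : ∀ x ∈ D, 0 ≤ V x) (hW : ContinuousOn W D)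
    (hVW : ∀ t : ℝ, ∀ x ∈ D, fderiv ℝ V x (f t x) ≤ W x) (hWnonpos : ∀ x ∈ D, W x ≤ 0)
    {x : ℝ → EuclideanSpace ℝ (Fin n)} {t₀ B : ℝ} (hx : IsSolOn D f x (Ici t₀))
    (hB : ∀ t, t₀ ≤ t → ‖f t (x t)‖ ≤ B) {p : EuclideanSpace ℝ (Fin n)} (hpD : p ∈ D)
    (hp : MapClusterPt p atTop x) : W p = 0 := by
  have hdec : ∀ a b, t₀ ≤ a → a ≤ b → V (x b) ≤ V (x a) := by
    intro a b ha hab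
    have hsub : Icc a b ⊆ Ici t₀ := fun s hs => ha.trans hs.1
    have := (hx.mono subset_rfl hsub).lyapunov_le hDopen hV (c := 0) hab fun s hs =>
      (hVW s _ (hx s (hsub hs)).1).trans (hWnonpos _ (hx s (hsub hs)).1)
    linarith
  have hlim : ∃ v, Tendsto (fun t => V (x t)) atTop (𝓝 v) := by
    have hanti : Antitone fun t => V (x (max t t₀)) := fun a b hab =>
      hdec _ _ (le_max_right _ _) (max_le_max_right _ hab)
    have hbd : BddBelow (range fun t => V (x (max t t₀))) :=
      ⟨0, by rintro _ ⟨t, rfl⟩; exact hVnonneg _ (hx _ (mem_Ici.2 (le_max_right _ _))).1⟩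
    refine ⟨_, (tendsto_atTop_ciInf hanti hbd).congr' ?_⟩
    filter_upwards [eventually_ge_atTop t₀] with t ht
    rw [max_eq_left ht]
  obtain ⟨v, hv⟩ := hlim
  by_contra hne
  have hneg : W p < 0 := lt_of_le_of_ne (hWnonpos p hpD) hne
  have hB0 : 0 ≤ B := (norm_nonneg _).trans (hB t₀ le_rfl)
  have hnear : ∀ᶠ q in 𝓝 p, q ∈ D ∧ W q < W p / 2 :=
    (hDopen.eventually_mem hpD).and
      ((hW.continuousAt (hDopen.mem_nhds hpD)).eventually_lt continuousAt_const (by linarith))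
  obtain ⟨ρ, hρ, hnear⟩ := Metric.eventually_nhds_iff.1 hnear
  set h : ℝ := ρ / 2 / (B + 1) with hh
  have hh0 : 0 < h := by positivity
  have hBh : B * h < ρ / 2 := by
    rw [hh, ← mul_div_assoc, div_lt_iff₀ (by positivity)]
    nlinarith
  have hdiff : ∀ᶠ t in atTop, V (x t) - V (x (t + h)) < -(W p / 2) * h := by
    have h1 : Tendsto (fun t => V (x (t + h))) atTop (𝓝 v) :=
      hv.comp (tendsto_atTop_add_const_right _ h tendsto_id)
    have h2 := hv.sub h1
    rw [sub_self] at h2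
    exact h2.eventually_lt_const (mul_pos (by linarith) hh0)
  have hfreq : ∃ᶠ t in atTop, dist (x t) p < ρ / 2 :=
    hp.frequently (ball_mem_nhds p (half_pos hρ))
  obtain ⟨t, htp, htV, ht⟩ := (hfreq.and_eventually (hdiff.and (eventually_ge_atTop t₀))).exists
  have hsub : Icc t (t + h) ⊆ Ici t₀ := fun s hs => ht.trans hs.1
  have hWs : ∀ s ∈ Icc t (t + h), W (x s) ≤ W p / 2 := by
    intro s hs
    have h1 := norm_image_sub_le_of_norm_deriv_le_segment' (f := x) (C := B) (a := t) (b := t + h)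
      (fun s hs => (hx s (hsub hs)).2.hasDerivWithinAt)
      (fun s hs => hB s (hsub (Ico_subset_Icc_self hs))) s hs
    have h2 : B * (s - t) ≤ B * h := by gcongr; linarith [hs.2]
    have h3 := dist_triangle (x s) (x t) p
    rw [dist_eq_norm (x s) (x t)] at h3
    exact (hnear (by linarith)).2.le
  have := (hx.mono subset_rfl hsub).lyapunov_le hDopen hV (c := W p / 2) (by linarith)
    fun s hs => (hVW s _ (hx s (hsub hs)).1).trans (hWs s hs)
  rw [add_sub_cancel_left] at this
  linarith

/-- The vector field becomes asymptotically autonomous along a bounded solution all of whose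
cluster points lie in a set where it is time-invariant. -/
theorem eventually_dist_field_le {S K : Set (EuclideanSpace ℝ (Fin n))} (hK : IsCompact K)
    {L : ℝ≥0} (hL : ∀ t, LipschitzOnWith L (f t) K) (hS : ∀ s t : ℝ, ∀ p ∈ S, f s p = f t p)
    {x : ℝ → EuclideanSpace ℝ (Fin n)} (hxK : ∀ᶠ t in atTop, x t ∈ K)
    (hcl : ∀ p ∈ K, MapClusterPt p atTop x → p ∈ S) {ε : ℝ} (hε : 0 < ε) :
    ∀ᶠ t in atTop, ∀ s, dist (f t (x t)) (f s (x t)) ≤ ε := by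
  by_contra hcon
  rw [not_eventually] at hcon
  set bad : Set ℝ := {t | ¬ ∀ s, dist (f t (x t)) (f s (x t)) ≤ ε} with hbad
  have : NeBot (atTop ⊓ 𝓟 bad) := frequently_mem_iff_neBot.1 hcon
  have hxK' : ∀ᶠ t in atTop ⊓ 𝓟 bad, x t ∈ K := hxK.filter_mono inf_le_left
  obtain ⟨p, hpK, hp⟩ := hK.exists_mapClusterPt_of_frequently hxK'.frequently
  have hpS := hcl p hpK (hp.mono inf_le_left)
  have hfreq : ∃ᶠ t in atTop ⊓ 𝓟 bad, dist (x t) p < ε / (2 * (L + 1)) :=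
    hp.frequently (ball_mem_nhds p (by positivity))
  have hbad' : ∀ᶠ t in atTop ⊓ 𝓟 bad, t ∈ bad := eventually_inf_principal.2 (.of_forall fun _ h => h)
  obtain ⟨t, htp, htK, htb⟩ := (hfreq.and_eventually (hxK'.and hbad')).exists
  refine htb fun s => ?_
  have h1 := (hL t).dist_le_mul _ htK _ hpK
  have h2 := (hL s).dist_le_mul _ hpK _ htK
  rw [dist_comm p] at h2
  have h3 := dist_triangle (f t (x t)) (f t p) (f s (x t))
  rw [hS t s p hpS] at h1 h3
  rw [lt_div_iff₀ (by positivity)] at htp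
  have : (0 : ℝ) ≤ dist (x t) p := dist_nonneg
  nlinarith

/-- The cluster set of a solution along which the vector field is asymptotically autonomous is
positively invariant. -/
theorem posInvariant_setOf_mapClusterPt
    (hlip : ∀ K ⊆ D, IsCompact K → ∃ L : ℝ≥0, ∀ t, LipschitzOnWith L (f t) K)
    {K : Set (EuclideanSpace ℝ (Fin n))} (hK : IsCompact K) (hKD : K ⊆ D)
    {x : ℝ → EuclideanSpace ℝ (Fin n)} {t₀ : ℝ} (hx : IsSolOn K f x (Ici t₀))
    (haut : ∀ ε > 0, ∀ᶠ t in atTop, ∀ s, dist (f t (x t)) (f s (x t)) ≤ ε) :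
    PosInvariant D f {p | MapClusterPt p atTop x} := by
  intro a b y hy hya t ht
  obtain ⟨L, hL⟩ := hlip (K ∪ y '' Icc a b)
    (union_subset hKD (image_subset_iff.2 fun s hs => (hy s hs).1))
    (hK.union (isCompact_Icc.image_of_continuousOn hy.continuousOn))
  refine mapClusterPt_iff_frequently.2 fun U hU => ?_
  obtain ⟨ε, hε, hεU⟩ := Metric.mem_nhds_iff.1 hU
  obtain ⟨δ, hδ, hgr⟩ := exists_gronwallBound_lt L (t - a) hε
  have hfreq : ∃ᶠ τ in atTop, dist (x τ) (y a) < δ :=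
    MapClusterPt.frequently hya (ball_mem_nhds _ hδ)
  obtain ⟨τ₁, hτ₁⟩ := eventually_atTop.1 (haut δ hδ)
  have hshift : Tendsto (fun τ : ℝ => τ + (t - a)) atTop atTop :=
    tendsto_atTop_add_const_right _ _ tendsto_id
  refine hshift.frequently ?_
  refine (hfreq.and_eventually
    ((eventually_ge_atTop τ₁).and (eventually_ge_atTop t₀))).mono ?_
  rintro τ ⟨hτ, hτ1, hτ0⟩
  refine hεU (lt_of_le_of_lt ?_ hgr)
  have hge : ∀ s ∈ Icc a b, τ ≤ s + (τ - a) := fun s hs => by linarith [hs.1]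
  have h := dist_le_gronwallBound_of_approx_solution (v := f) (x := fun s => x (s + (τ - a)))
    (x' := fun s => f (s + (τ - a)) (x (s + (τ - a)))) (y := y) (ε := δ) (δ := δ) hL
    (fun s hs => (hx (s + (τ - a)) (hτ0.trans (hge s hs))).2.comp_add_const s (τ - a))
    (fun s hs => Or.inl (hx (s + (τ - a)) (hτ0.trans (hge s hs))).1)
    (fun s hs => hτ₁ _ (hτ1.trans (hge s hs)) s)
    (fun s hs => (hy s hs).2) (fun s hs => Or.inr (mem_image_of_mem _ hs))
    (by simpa using hτ.le) t ht
  rwa [show t + (τ - a) = τ + (t - a) by ring] at h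

theorem uniformlyAsympStable_of_asympStableOn_maxPosInv (hDopen : IsOpen D)
    (h0D : (0 : EuclideanSpace ℝ (Fin n)) ∈ D)
    (hlip : ∀ K ⊆ D, IsCompact K → ∃ L : ℝ≥0, ∀ t, LipschitzOnWith L (f t) K)
    (hcont : ∀ x ∈ D, Continuous fun t => f t x)
    (hbdd : ∀ K ⊆ D, IsCompact K → ∃ B : ℝ, ∀ t, ∀ x ∈ K, ‖f t x‖ ≤ B)
    (hV : ContDiffOn ℝ 1 V D) (hVnonneg : ∀ x ∈ D, 0 ≤ V x) (hV0 : V 0 = 0)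
    (hW : ContinuousOn W D)
    (hVW : ∀ t : ℝ, ∀ x ∈ D, fderiv ℝ V x (f t x) ≤ W x) (hWnonpos : ∀ x ∈ D, W x ≤ 0)
    (htinv : ∀ t t₀ : ℝ, ∀ x ∈ {y ∈ D | W y = 0}, f t x = f t₀ x)
    (hN : AsympStableOn (MaxPosInv D f {y ∈ D | W y = 0}) f) : UniformlyAsympStable D f := by
  have hus := uniformlyStable_of_asympStableOn_maxPosInv hDopen h0D hlip hcont hbdd hV hVnonneg
    hV0 hVW hWnonpos htinv hN
  have hND : MaxPosInv D f {y ∈ D | W y = 0} ⊆ D := maxPosInv_subset.trans fun _ h => h.1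
  refine ⟨hus, ?_⟩
  obtain ⟨R, hR, hRD⟩ := nhds_basis_closedBall.mem_iff.1 (hDopen.mem_nhds h0D)
  obtain ⟨δ₁, hδ₁, hatt⟩ := hN.2 0
  obtain ⟨r, hr, hrR, hrδ⟩ : ∃ r > 0, r ≤ R ∧ r < δ₁ :=
    ⟨min R (δ₁ / 2), lt_min hR (half_pos hδ₁), min_le_left _ _,
      (min_le_right _ _).trans_lt (half_lt_self hδ₁)⟩
  have hK : IsCompact (closedBall (0 : EuclideanSpace ℝ (Fin n)) r) := isCompact_closedBall _ _
  have hKD : closedBall (0 : EuclideanSpace ℝ (Fin n)) r ⊆ D :=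
    (closedBall_subset_closedBall hrR).trans hRD
  obtain ⟨L, hL⟩ := hlip _ hKD hK
  obtain ⟨B, hB⟩ := hbdd _ hKD hK
  obtain ⟨δ, hδ, hstab⟩ := hus r hr
  refine ⟨min δ r, lt_min hδ hr, fun t₀ x₀ hx₀D hx₀ => ?_⟩
  obtain ⟨x, hx0, hx, hxr⟩ := hstab t₀ x₀ hx₀D (hx₀.trans_le (min_le_left _ _))
  refine ⟨x, hx0, hx, ?_⟩
  have hxK : IsSolOn (closedBall 0 r) f x (Ici t₀) := by
    refine fun t ht => ⟨?_, (hx t ht).2⟩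
    rw [mem_closedBall_zero_iff]
    rcases (mem_Ici.1 ht).eq_or_lt with rfl | ht
    · rw [hx0]; exact (hx₀.trans_le (min_le_right _ _)).le
    · exact (hxr t ht).le
  have hxK' : ∀ᶠ t in atTop, x t ∈ closedBall (0 : EuclideanSpace ℝ (Fin n)) r :=
    (eventually_ge_atTop t₀).mono fun t ht => (hxK t ht).1
  have hclK : ∀ p, MapClusterPt p atTop x → p ∈ closedBall (0 : EuclideanSpace ℝ (Fin n)) r := by
    intro p hp
    by_contra hpr
    obtain ⟨t, ht, ht'⟩ := ((hp.frequently
      (isClosed_closedBall.isOpen_compl.mem_nhds hpr)).and_eventually hxK').exists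
    exact ht ht'
  have hclE : ∀ p, MapClusterPt p atTop x → p ∈ {y ∈ D | W y = 0} := fun p hp =>
    ⟨hKD (hclK p hp), hx.eq_zero_of_mapClusterPt hDopen hV hVnonneg hW hVW hWnonpos
      (fun t ht => hB t _ (hxK t ht).1) (hKD (hclK p hp)) hp⟩
  have hinv : PosInvariant D f {p | MapClusterPt p atTop x} :=
    posInvariant_setOf_mapClusterPt hlip hK hKD hxK fun ε hε =>
      eventually_dist_field_le hK hL htinv hxK' (fun p _ => hclE p) hε
  obtain ⟨p, hpK, hp⟩ := hK.exists_mapClusterPt_of_frequently hxK'.frequently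
  obtain ⟨y, hy0, hy, hylim⟩ := hatt p ⟨_, ⟨hclE, hinv⟩, hp⟩
    ((mem_closedBall_zero_iff.1 hpK).trans_lt hrδ)
  have hycl := hinv.isSolOn_Ici (hy.mono hND subset_rfl) (by rw [hy0]; exact hp)
  rw [Metric.tendsto_nhds]
  intro ε hε
  obtain ⟨η, hη, hstabε⟩ := hus ε hε
  obtain ⟨T, hTη, hT⟩ := ((hylim.norm.eventually_lt_const
    (show ‖(0 : EuclideanSpace ℝ (Fin n))‖ < η by simpa using hη)).and
    (eventually_ge_atTop (0 : ℝ))).exists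
  have hfreq : ∃ᶠ t in atTop, ‖x t‖ < η :=
    MapClusterPt.frequently (hycl T hT).1 (continuous_norm.continuousAt.eventually_lt_const hTη)
  obtain ⟨τ, hτη, hτ⟩ := (hfreq.and_eventually (eventually_ge_atTop t₀)).exists
  obtain ⟨z, hz0, hz, hzε⟩ := hstabε τ (x τ) (hx τ hτ).1 hτη
  have hEq := (hx.mono subset_rfl (Ici_subset_Ici.2 hτ)).eqOn_Ici hlip hz hz0.symm
  filter_upwards [eventually_gt_atTop τ] with t ht
  rw [hEq (mem_Ici.2 ht.le), dist_zero_right]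
  exact hzε t ht

end Dynamics

/-- Theorem 1 of the paper: under the stated regularity assumptions on `f`,
a nonnegative `C¹` function `V` with `∇V · f ≤ W ≤ 0`, and time-invariance of `f` on the
zero set `E` of `W`, the origin is uniformly asymptotically stable for `ẋ = f t x`
iff it is asymptotically stable for the dynamics restricted to the maximal positively
invariant set `N ⊆ E`. -/
theorem uniformly_asympStable_iff_asympStable_restricted
    {n : ℕ} (D : Set (EuclideanSpace ℝ (Fin n))) (hDopen : IsOpen D)
    (hDconn : IsConnected D) (h0D : (0 : EuclideanSpace ℝ (Fin n)) ∈ D)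
    (f : ℝ → EuclideanSpace ℝ (Fin n) → EuclideanSpace ℝ (Fin n))
    (hf0 : ∀ t : ℝ, f t 0 = 0)
    (hf_unif_t : ∀ ε > (0 : ℝ), ∃ δ > (0 : ℝ), ∀ t₁ t₂ : ℝ, |t₁ - t₂| < δ →
      ∀ x ∈ D, ‖f t₁ x - f t₂ x‖ < ε)
    (hf_lip : ∀ K : Set (EuclideanSpace ℝ (Fin n)), K ⊆ D → IsCompact K →
      ∃ L > (0 : ℝ), ∀ t : ℝ, ∀ x ∈ K, ∀ y ∈ K, ‖f t x - f t y‖ ≤ L * ‖x - y‖)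
    (M : EuclideanSpace ℝ (Fin n) → ℝ) (hM : ContinuousOn M D)
    (hf_bdd : ∀ t : ℝ, ∀ x ∈ D, ‖f t x‖ ≤ M x)
    (V : EuclideanSpace ℝ (Fin n) → ℝ) (hV : ContDiffOn ℝ 1 V D)
    (hVnonneg : ∀ x ∈ D, 0 ≤ V x) (hV0 : V 0 = 0)
    (W : EuclideanSpace ℝ (Fin n) → ℝ) (hW : ContinuousOn W D)
    (hVW : ∀ t : ℝ, ∀ x ∈ D, fderiv ℝ V x (f t x) ≤ W x)
    (hWnonpos : ∀ x ∈ D, W x ≤ 0)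
    (htinv : ∀ t t₀ : ℝ, ∀ x ∈ {y ∈ D | W y = 0}, f t x = f t₀ x) :
    UniformlyAsympStable D f ↔ AsympStableOn (MaxPosInv D f {y ∈ D | W y = 0}) f := by
  have hND : MaxPosInv D f {y ∈ D | W y = 0} ⊆ D := maxPosInv_subset.trans fun _ h => h.1
  refine ⟨fun h => h.asympStableOn hND posInvariant_maxPosInv,
    uniformlyAsympStable_of_asympStableOn_maxPosInv hDopen h0D ?_ ?_ ?_ hV hVnonneg hV0 hW hVW
      hWnonpos htinv⟩
  · intro K hKD hK
    obtain ⟨L, hL, h⟩ := hf_lip K hKD hK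
    refine ⟨L.toNNReal, fun t => LipschitzOnWith.of_dist_le_mul fun x hx y hy => ?_⟩
    rw [Real.coe_toNNReal _ hL.le, dist_eq_norm, dist_eq_norm]
    exact h t x hx y hy
  · intro x hx
    refine Metric.continuous_iff.2 fun t ε hε => ?_
    obtain ⟨δ, hδ, h⟩ := hf_unif_t ε hε
    exact ⟨δ, hδ, fun s hs => by simpa [dist_eq_norm] using h s t hs x hx⟩
  · intro K hKD hK
    obtain ⟨B, hB⟩ := hK.bddAbove_image (hM.mono hKD)
    exact ⟨B, fun t x hx => (hf_bdd t x (hKD hx)).trans (hB (mem_image_of_mem _ hx))⟩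
end

section
/- Let V : D → ℝ be C¹ on a domain D ⊆ ℝⁿ, f, g locally Lipschitz vector fields on D, h : D → ℝ, φ : ℝ → ℝ, a > 0, and suppose the Hamilton–Jacobi inequality ∇V(x)·f(x) + (½ ∇V(x)·g(x) + φ(h(x)))² − (1 − a²)(φ(h(x)))² ≤ 0 holds at a point x ∈ D. Then for every real number u (interpreted as the perturbed feedback value φ(h(x)) + p, where p is the perturbation value) one has ∇V(x)·( f(x) + g(x)(φ(h(x)) + p) ) ≤ −(½ ∇V(x)·g(x) − p)² + p² − a²(φ(h(x)))², for every p ∈ ℝ. In particular, if |p| ≤ a|φ(h(x))| then ∇V(x)·( f(x) + g(x)(φ(h(x)) + p) ) ≤ p² − a²(φ(h(x)))² ≤ 0. -/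
open Set Filter Metric Topology

/-- `f` is locally Lipschitz on the set `D`. -/
def LocLipOn {n : ℕ} {F : Type*} [NormedAddCommGroup F]
    (D : Set (EuclideanSpace ℝ (Fin n))) (f : EuclideanSpace ℝ (Fin n) → F) : Prop :=
  ∀ x ∈ D, ∃ ε > (0 : ℝ), ∃ L : ℝ, 0 ≤ L ∧
    ∀ y ∈ D ∩ ball x ε, ∀ z ∈ D ∩ ball x ε, ‖f y - f z‖ ≤ L * ‖y - z‖

/-- the pointwise algebraic estimate on the derivative of `V` along the
perturbed closed-loop vector field `ẋ = f x + (φ (h x) + p) • g x`, deduced from the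
Hamilton–Jacobi inequality at the point `x`. -/
theorem deriv_along_perturbed_closed_loop_le
    {n : ℕ} (D : Set (EuclideanSpace ℝ (Fin n))) (hDopen : IsOpen D)
    (V : EuclideanSpace ℝ (Fin n) → ℝ) (hV : ContDiffOn ℝ 1 V D)
    (f g : EuclideanSpace ℝ (Fin n) → EuclideanSpace ℝ (Fin n))
    (hf : LocLipOn D f) (hg : LocLipOn D g)
    (h : EuclideanSpace ℝ (Fin n) → ℝ) (φ : ℝ → ℝ) (a : ℝ) (ha : 0 < a)
    (x : EuclideanSpace ℝ (Fin n)) (hx : x ∈ D)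
    (hHJ : fderiv ℝ V x (f x) +
      (2⁻¹ * fderiv ℝ V x (g x) + φ (h x)) ^ 2 - (1 - a ^ 2) * (φ (h x)) ^ 2 ≤ 0) :
    (∀ p : ℝ, fderiv ℝ V x (f x + (φ (h x) + p) • g x) ≤
        -(2⁻¹ * fderiv ℝ V x (g x) - p) ^ 2 + p ^ 2 - a ^ 2 * (φ (h x)) ^ 2) ∧
    (∀ p : ℝ, |p| ≤ a * |φ (h x)| →
        fderiv ℝ V x (f x + (φ (h x) + p) • g x) ≤ p ^ 2 - a ^ 2 * (φ (h x)) ^ 2 ∧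
        p ^ 2 - a ^ 2 * (φ (h x)) ^ 2 ≤ 0) := by
  have key : ∀ p : ℝ, fderiv ℝ V x (f x + (φ (h x) + p) • g x) ≤
      -(2⁻¹ * fderiv ℝ V x (g x) - p) ^ 2 + p ^ 2 - a ^ 2 * (φ (h x)) ^ 2 := by
    intro p
    rw [map_add, map_smul, smul_eq_mul]
    linarith
  refine ⟨key, fun p hp => ⟨?_, ?_⟩⟩
  · linarith [key p, sq_nonneg (2⁻¹ * fderiv ℝ V x (g x) - p)]
  · have hsq : p ^ 2 ≤ (a * φ (h x)) ^ 2 :=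
      sq_le_sq.mpr (by rwa [abs_mul, abs_of_pos ha])
    linarith [mul_pow a (φ (h x)) 2]
end

section
/- Consider the autonomous planar system ẋ = y², ẏ = −y³ on ℝ². The equilibrium (0,0) is not stable: there exists ε₀ > 0 such that for every δ > 0 there is an initial condition (x₀,y₀) with ‖(x₀,y₀)‖ < δ and a time t > 0 for which the solution through (x₀,y₀) at time t has norm at least ε₀. Nevertheless, taking V(x,y) = y², one has dV/dt = −2y⁴ ≤ 0 along solutions, and on the set E = N = {(x,0) : x ∈ ℝ} the restricted dynamics is ẋ = 0, for which the origin is stable. -/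
open Set Filter Metric Topology

/-- The explicit solution of `ẋ = y²`, `ẏ = −y³` with initial condition `(0, a)`. -/
theorem hasDerivAt_log_inv_sqrt (a s : ℝ) (hs : 0 < 1 + 2 * a ^ 2 * s) :
    HasDerivAt (fun τ : ℝ => (Real.log (1 + 2 * a ^ 2 * τ) / 2, a / √(1 + 2 * a ^ 2 * τ)))
      ((a / √(1 + 2 * a ^ 2 * s)) ^ 2, -(a / √(1 + 2 * a ^ 2 * s)) ^ 3) s := by
  have hw : HasDerivAt (fun τ : ℝ => 1 + 2 * a ^ 2 * τ) (2 * a ^ 2) s := by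
    simpa using ((hasDerivAt_id s).const_mul (2 * a ^ 2)).const_add 1
  have hr : 0 < √(1 + 2 * a ^ 2 * s) := Real.sqrt_pos.2 hs
  have hsq : √(1 + 2 * a ^ 2 * s) ^ 2 = 1 + 2 * a ^ 2 * s := Real.sq_sqrt hs.le
  refine HasDerivAt.prodMk ?_ ?_
  · refine ((hw.log hs.ne').div_const 2).congr_deriv ?_
    rw [div_pow, hsq]
    field_simp
  · refine ((hasDerivAt_const s a).div (hw.sqrt hs.ne') hr.ne').congr_deriv ?_
    field_simp
    ring

/-- Example 1 of the paper: for the planar system `ẋ = y²`, `ẏ = −y³`: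
(i) the origin is not stable; (ii) with `V (x,y) = y²` one has `dV/dt = −2 y⁴ ≤ 0` along
solutions; (iii) the restricted dynamics on `E = N = {(x, 0)}`, namely `ẋ = 0`, is stable
at the origin. -/
theorem vinograd_type_example :
    -- (i) the equilibrium `(0,0)` is not stable :
    (∃ ε₀ > (0 : ℝ), ∀ δ > (0 : ℝ),
      ∃ (z₀ : ℝ × ℝ) (t : ℝ) (u : ℝ → ℝ × ℝ), ‖z₀‖ < δ ∧ 0 < t ∧ u 0 = z₀ ∧
        (∀ s ∈ Icc (0 : ℝ) t, HasDerivAt u (((u s).2) ^ 2, -((u s).2) ^ 3) s) ∧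
        ε₀ ≤ ‖u t‖) ∧
    -- (ii) along any solution, `V = y²` satisfies `dV/dt = −2 y⁴ ≤ 0` :
    (∀ (u : ℝ → ℝ × ℝ) (s : ℝ), HasDerivAt u (((u s).2) ^ 2, -((u s).2) ^ 3) s →
      HasDerivAt (fun τ => ((u τ).2) ^ 2) (-2 * ((u s).2) ^ 4) s ∧
        -2 * ((u s).2) ^ 4 ≤ 0) ∧
    -- (iii) the restricted dynamics `ẋ = 0` on `E = N = {(x,0)}` is stable at the origin :
    (∀ ε > (0 : ℝ), ∃ δ > (0 : ℝ), ∀ u : ℝ → ℝ,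
      (∀ t ≥ (0 : ℝ), HasDerivAt u 0 t) → |u 0| < δ → ∀ t ≥ (0 : ℝ), |u t| < ε) := by
  refine ⟨⟨1, one_pos, fun δ hδ => ?_⟩, fun u s hu => ⟨?_, ?_⟩, fun ε hε => ⟨ε, hε, ?_⟩⟩
  · have ha : 0 < δ / 2 := half_pos hδ
    have he : 0 < Real.exp 2 - 1 := sub_pos.2 (Real.one_lt_exp_iff.2 two_pos)
    refine ⟨(0, δ / 2), (Real.exp 2 - 1) / (2 * (δ / 2) ^ 2),
      fun τ => (Real.log (1 + 2 * (δ / 2) ^ 2 * τ) / 2, δ / 2 / √(1 + 2 * (δ / 2) ^ 2 * τ)),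
      ?_, by positivity, by simp, fun s hs => ?_, ?_⟩
    · rw [Prod.norm_mk, norm_zero, Real.norm_of_nonneg ha.le, max_eq_right ha.le]
      exact half_lt_self hδ
    · have := hs.1
      exact hasDerivAt_log_inv_sqrt _ s (by positivity)
    · refine le_trans (le_of_eq ?_) (norm_fst_le _)
      have hne : 2 * (δ / 2) ^ 2 ≠ 0 := by positivity
      dsimp only
      rw [mul_div_cancel₀ _ hne, add_sub_cancel, Real.log_exp]
      norm_num
  · have hy : HasDerivAt (fun τ => (u τ).2) (-(u s).2 ^ 3) s := hu.snd
    refine (hy.pow 2).congr_deriv ?_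
    push_cast
    ring
  · have : 0 ≤ (u s).2 ^ 4 := by positivity
    linarith
  · intro u hu h0 t ht
    have h := constant_of_has_deriv_right_zero (a := 0) (b := t)
      (fun x hx => (hu x hx.1).continuousAt.continuousWithinAt)
      (fun x hx => (hu x hx.1).hasDerivWithinAt) t ⟨ht, le_rfl⟩
    rwa [h]
end

section
/- Let Ψ : ℝ → ℝ be locally Lipschitz with Ψ(0) = 0, and suppose there exist constants a > 0 and b ≥ 1 such that |Ψ(s)| ≤ a|s|^b for all s ∈ ℝ. Then the origin (0,0) is an asymptotically stable equilibrium of the planar system ẋ₁ = −x₁³ + Ψ(x₂), ẋ₂ = −x₂³. -/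
open Set Filter Metric Topology

/-- A time-dependent vector field which is bounded, continuous in time and globally Lipschitz in
space has a global integral curve through every point. -/
theorem exists_global_hasDerivAt_of_bounded_of_lipschitz
    {E : Type*} [NormedAddCommGroup E] [NormedSpace ℝ E] [CompleteSpace E]
    {f : ℝ → E → E} {K L : NNReal} (hlip : ∀ t, LipschitzWith K (f t))
    (hcont : ∀ x, Continuous fun t => f t x) (hbd : ∀ t x, ‖f t x‖ ≤ L) (x₀ : E) :
    ∃ x : ℝ → E, x 0 = x₀ ∧ ∀ t, HasDerivAt x (f t (x t)) t := by
  have local_solution : ∀ n : ℕ, ∃ α : ℝ → E, α 0 = x₀ ∧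
      ∀ t ∈ Ioo (-(n + 1 : ℝ)) (n + 1), HasDerivAt α (f t (α t)) t := by
    intro n
    have hn : (0 : ℝ) < n + 1 := by positivity
    have hpl : IsPicardLindelof f (tmin := -(n + 1 : ℝ)) (tmax := n + 1)
        ⟨0, by constructor <;> linarith⟩ x₀ (L * (n + 1)) 0 L K :=
      { lipschitzOnWith := fun t _ => (hlip t).lipschitzOnWith
        continuousOn := fun x _ => (hcont x).continuousOn
        norm_le := fun t _ x _ => hbd t x
        mul_max_le := by simp }
    obtain ⟨α, hα0, hα⟩ := hpl.exists_eq_forall_mem_Icc_hasDerivWithinAt₀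
    exact ⟨α, hα0, fun t ht =>
      (hα t (Ioo_subset_Icc_self ht)).hasDerivAt (Icc_mem_nhds ht.1 ht.2)⟩
  choose α hα0 hα using local_solution
  have agree : ∀ {m n : ℕ}, m ≤ n → EqOn (α m) (α n) (Ioo (-(m + 1 : ℝ)) (m + 1)) := by
    intro m n hmn
    have hmn' : (m : ℝ) ≤ n := by exact_mod_cast hmn
    refine ODE_solution_unique_of_mem_Ioo (v := f) (s := fun _ => univ) (K := K) (t₀ := 0)
      (fun t _ => (hlip t).lipschitzOnWith) ?_ (fun t ht => ⟨hα m t ht, mem_univ _⟩)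
      (fun t ht => ⟨hα n t ⟨?_, ?_⟩, mem_univ _⟩) (by rw [hα0, hα0])
    · have : (0 : ℝ) < m + 1 := by positivity
      constructor <;> linarith
    · linarith [ht.1]
    · linarith [ht.2]
  refine ⟨fun t => α ⌊|t|⌋₊ t, hα0 _, fun t => ?_⟩
  have mem : ∀ s : ℝ, s ∈ Ioo (-((⌊|s|⌋₊ : ℕ) + 1 : ℝ)) ((⌊|s|⌋₊ : ℕ) + 1) := fun s =>
    abs_lt.mp (Nat.lt_floor_add_one |s|)
  have key : ∀ (n : ℕ), ∀ s ∈ Ioo (-(n + 1 : ℝ)) (n + 1), α ⌊|s|⌋₊ s = α n s := by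
    intro n s hs
    rcases le_total ⌊|s|⌋₊ n with h | h
    · exact agree h (mem s)
    · exact (agree h hs).symm
  exact (hα _ t (mem t)).congr_of_eventuallyEq <|
    (isOpen_Ioo.eventually_mem (mem t)).mono fun s hs => key _ s hs

/-- Fencing estimate for solutions of `ẋ = -p + g` whenever `p` agrees with `x³` in the
region under consideration and `g` is small. -/
theorem sq_le_add_mul_exp_of_hasDerivAt_neg_cube
    {x p g : ℝ → ℝ} {ε C T : ℝ} (hε : 0 < ε) (hC : 0 ≤ C)
    (hx : ∀ t ≥ T, HasDerivAt x (-p t + g t) t)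
    (hp : ∀ t ≥ T, x t ^ 2 ≤ ε ^ 2 + C → p t = x t ^ 3)
    (hg : ∀ t ≥ T, |g t| ≤ ε ^ 3 / 4) (hT : x T ^ 2 ≤ ε ^ 2 + C) :
    ∀ t ≥ T, x t ^ 2 ≤ ε ^ 2 + C * Real.exp (-ε ^ 2 * (t - T)) := by
  intro t ht
  have hB : ∀ s, HasDerivAt (fun s => ε ^ 2 + C * Real.exp (-ε ^ 2 * (s - T)))
      (C * (Real.exp (-ε ^ 2 * (s - T)) * (-ε ^ 2))) s := fun s => by
    simpa using (((((hasDerivAt_id s).sub_const T).const_mul (-ε ^ 2)).exp).const_mul C).const_add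
      (ε ^ 2)
  have hV : ∀ s ≥ T, HasDerivAt (fun s => x s ^ 2) (2 * x s * (-p s + g s)) s := fun s hs => by
    simpa [Pi.pow_def] using (hx s hs).pow 2
  refine image_le_of_deriv_right_lt_deriv_boundary (f := fun s => x s ^ 2) (a := T) (b := t)
    (f' := fun s => 2 * x s * (-p s + g s))
    (fun s hs => (hV s hs.1).continuousAt.continuousWithinAt)
    (fun s hs => (hV s hs.1).hasDerivWithinAt) (by simpa using hT) hB ?_ ⟨ht, le_rfl⟩
  intro s hs heq
  have he0 : 0 < Real.exp (-ε ^ 2 * (s - T)) := Real.exp_pos _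
  have he1 : Real.exp (-ε ^ 2 * (s - T)) ≤ 1 := Real.exp_le_one_iff.mpr <| by
    nlinarith [hs.1, sq_nonneg ε]
  generalize Real.exp (-ε ^ 2 * (s - T)) = e at *
  rw [hp s hs.1 (by nlinarith)]
  have hCe : 0 ≤ C * e := by positivity
  have hle : ε ≤ |x s| := by
    refine le_of_abs_le (sq_le_sq.mp ?_)
    linarith
  have hxg : x s * g s ≤ |x s| * (ε ^ 3 / 4) :=
    (le_abs_self _).trans (by rw [abs_mul]; gcongr; exact hg s hs.1)
  have hx4_le : |x s| * ε ^ 3 ≤ x s ^ 4 := by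
    calc |x s| * ε ^ 3 ≤ |x s| * |x s| ^ 3 := by gcongr
      _ = x s ^ 4 := by rw [← pow_succ', Even.pow_abs (by decide)]
  have hx4_eq : x s ^ 4 = (ε ^ 2 + C * e) * x s ^ 2 := by rw [← heq]; ring
  have hε2 : 0 < ε ^ 2 := by positivity
  nlinarith [mul_nonneg hCe hCe, mul_nonneg hCe hε2.le, mul_pos hε2 hε2]

theorem lipschitzWith_cube_projIcc {R : NNReal} (h : -(R : ℝ) ≤ R) :
    LipschitzWith (3 * R ^ 2) fun x : ℝ => (projIcc (-(R : ℝ)) R h x : ℝ) ^ 3 := by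
  refine LipschitzWith.of_dist_le_mul fun x y => ?_
  have hxy := (LipschitzWith.projIcc h).dist_le_mul x y
  rw [Subtype.dist_eq, Real.dist_eq, NNReal.coe_one, one_mul] at hxy
  have hcR := abs_le.mpr (projIcc (-(R : ℝ)) R h x).2
  have hdR := abs_le.mpr (projIcc (-(R : ℝ)) R h y).2
  simp only [Real.dist_eq, NNReal.coe_mul, NNReal.coe_pow, NNReal.coe_ofNat] at hxy ⊢
  generalize (projIcc (-(R : ℝ)) R h x : ℝ) = c at *
  generalize (projIcc (-(R : ℝ)) R h y : ℝ) = d at *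
  have hq : |c ^ 2 + c * d + d ^ 2| ≤ 3 * (R : ℝ) ^ 2 := by
    calc |c ^ 2 + c * d + d ^ 2| ≤ |c ^ 2| + |c * d| + |d ^ 2| := abs_add_three _ _ _
      _ = |c| * |c| + |c| * |d| + |d| * |d| := by rw [abs_mul, abs_pow, abs_pow]; ring
      _ ≤ R * R + R * R + R * R := by gcongr
      _ = 3 * (R : ℝ) ^ 2 := by ring
  calc |c ^ 3 - d ^ 3| = |c ^ 2 + c * d + d ^ 2| * |c - d| := by rw [← abs_mul]; ring_nf
    _ ≤ 3 * (R : ℝ) ^ 2 * |x - y| := by gcongr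

/-- The scalar equation `ẋ = -x³ + g` with a small continuous forcing term `g` has global forward
solutions staying in an invariant interval, and they decay if `g` does. -/
theorem exists_solution_neg_cube_add {g : ℝ → ℝ} (hgc : Continuous g) {R : ℝ} (hR : 0 < R)
    (hg : ∀ t, |g t| ≤ R ^ 3 / 4) (hg0 : Tendsto g atTop (𝓝 0)) {x₀ : ℝ} (hx₀ : |x₀| ≤ R) :
    ∃ x : ℝ → ℝ, x 0 = x₀ ∧ (∀ t ≥ 0, HasDerivAt x (-x t ^ 3 + g t) t) ∧
      (∀ t ≥ 0, |x t| ≤ R) ∧ Tendsto x atTop (𝓝 0) := by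
  lift R to NNReal using hR.le
  have hRR : -(R : ℝ) ≤ R := by linarith
  set p : ℝ → ℝ := fun x => (projIcc (-(R : ℝ)) R hRR x : ℝ) ^ 3 with hp
  have hpeq : ∀ x : ℝ, |x| ≤ R → p x = x ^ 3 := fun x hx => by
    simp only [hp, projIcc_of_mem hRR (abs_le.mp hx)]
  have hpbd : ∀ x : ℝ, |p x| ≤ (R : ℝ) ^ 3 := fun x => by
    rw [hp, abs_pow]
    gcongr
    exact abs_le.mpr (projIcc (-(R : ℝ)) R hRR x).2
  obtain ⟨x, hx0, hx⟩ := exists_global_hasDerivAt_of_bounded_of_lipschitz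
    (f := fun t x => -p x + g t) (K := 3 * R ^ 2) (L := 2 * R ^ 3)
    (fun t => by
      refine LipschitzWith.of_dist_le_mul fun y z => ?_
      rw [dist_add_right, dist_neg_neg]
      exact (lipschitzWith_cube_projIcc hRR).dist_le_mul y z)
    (fun y => by fun_prop)
    (fun t y => by
      refine (norm_add_le _ _).trans ?_
      rw [norm_neg, Real.norm_eq_abs, Real.norm_eq_abs]
      push_cast
      have := hpbd y
      have := hg t
      have : 0 < (R : ℝ) ^ 3 := by positivity
      linarith) x₀
  have hbound : ∀ t ≥ 0, |x t| ≤ R := fun t ht => by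
    have := sq_le_add_mul_exp_of_hasDerivAt_neg_cube (C := 0) (T := 0) hR le_rfl
      (fun t _ => hx t) (fun t _ h => hpeq _ (abs_le_of_sq_le_sq (by simpa using h) hR.le))
      (fun t _ => hg t) (by rw [hx0]; simpa using sq_le_sq' (abs_le.mp hx₀).1 (abs_le.mp hx₀).2)
      t ht
    exact abs_le_of_sq_le_sq (by simpa using this) hR.le
  have hx' : ∀ t ≥ 0, HasDerivAt x (-x t ^ 3 + g t) t := fun t ht => by
    rw [← hpeq _ (hbound t ht)]
    exact hx t
  refine ⟨x, hx0, hx', hbound, ?_⟩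
  rw [Metric.tendsto_atTop']
  intro ε hε
  obtain ⟨η, hη, hηε⟩ : ∃ η > 0, η ^ 2 + η ^ 2 = ε ^ 2 / 2 :=
    ⟨ε / 2, by positivity, by ring⟩
  have hsmall : ∀ᶠ t in atTop, |g t| < η ^ 3 / 4 := by
    simpa [Real.dist_eq] using
      (Metric.tendsto_nhds.mp hg0) (η ^ 3 / 4) (by positivity)
  obtain ⟨T, hT⟩ := eventually_atTop.mp (hsmall.and (eventually_ge_atTop 0))
  have hdecay := sq_le_add_mul_exp_of_hasDerivAt_neg_cube (x := x) (p := fun t => x t ^ 3)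
    (C := x T ^ 2) hη (sq_nonneg _) (fun t ht => hx' t (hT t ht).2) (fun _ _ _ => rfl)
    (fun t ht => (hT t ht).1.le) (by linarith [sq_nonneg η])
  have hlim : Tendsto (fun t => x T ^ 2 * Real.exp (-η ^ 2 * (t - T))) atTop (𝓝 0) := by
    have h1 : Tendsto (fun t : ℝ => -η ^ 2 * (t - T)) atTop atBot :=
      (tendsto_atTop_add_const_right _ (-T) tendsto_id).const_mul_atTop_of_neg
        (neg_neg_of_pos (by positivity))
    simpa using (Real.tendsto_exp_atBot.comp h1).const_mul (x T ^ 2)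
  obtain ⟨S, hS⟩ := eventually_atTop.mp
    ((hlim.eventually (gt_mem_nhds (show 0 < η ^ 2 by positivity))).and (eventually_ge_atTop T))
  refine ⟨S, fun t ht => ?_⟩
  rw [Real.dist_eq, sub_zero]
  refine abs_lt_of_sq_lt_sq ?_ hε.le
  have := hdecay t (hS t ht.le).2
  have := (hS t ht.le).1
  have : 0 < ε ^ 2 := by positivity
  linarith

theorem hasDerivAt_div_sqrt_neg_cube (y₀ : ℝ) {t : ℝ} (ht : 0 ≤ t) :
    HasDerivAt (fun t => y₀ / √(1 + 2 * y₀ ^ 2 * t))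
      (-(y₀ / √(1 + 2 * y₀ ^ 2 * t)) ^ 3) t := by
  have hpos : 0 < 1 + 2 * y₀ ^ 2 * t := by positivity
  have hs : 0 < √(1 + 2 * y₀ ^ 2 * t) := Real.sqrt_pos.mpr hpos
  have h1 : HasDerivAt (fun t => 1 + 2 * y₀ ^ 2 * t) (2 * y₀ ^ 2) t := by
    simpa using ((hasDerivAt_id t).const_mul (2 * y₀ ^ 2)).const_add 1
  refine ((hasDerivAt_const t y₀).div (h1.sqrt hpos.ne') hs.ne').congr_deriv ?_
  field_simp
  ring

theorem abs_div_sqrt_le (y₀ : ℝ) {t : ℝ} (ht : 0 ≤ t) :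
    |y₀ / √(1 + 2 * y₀ ^ 2 * t)| ≤ |y₀| := by
  rw [abs_div, abs_of_nonneg (Real.sqrt_nonneg _)]
  refine div_le_self (abs_nonneg _) (Real.one_le_sqrt.mpr ?_)
  have : 0 ≤ 2 * y₀ ^ 2 * t := by positivity
  linarith

theorem tendsto_div_sqrt_atTop (y₀ : ℝ) :
    Tendsto (fun t => y₀ / √(1 + 2 * y₀ ^ 2 * t)) atTop (𝓝 0) := by
  rcases eq_or_ne y₀ 0 with rfl | hy
  · simp
  · exact (Real.tendsto_sqrt_atTop.comp <| tendsto_atTop_add_const_left _ 1 <|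
      tendsto_id.const_mul_atTop (show 0 < 2 * y₀ ^ 2 by positivity)).const_div_atTop y₀

/-- For continuous `Ψ` vanishing at `0`, the cascade `ẋ₁ = -x₁³ + Ψ x₂`, `ẋ₂ = -x₂³` has, near the
origin, solutions which remain small and converge to the origin. -/
theorem exists_small_solution_tendsto_zero {Ψ : ℝ → ℝ} (hΨ : Continuous Ψ) (hΨ0 : Ψ 0 = 0)
    {ε : ℝ} (hε : 0 < ε) :
    ∃ δ > (0 : ℝ), ∀ z₀ : ℝ × ℝ, ‖z₀‖ < δ → ∃ u : ℝ → ℝ × ℝ, u 0 = z₀ ∧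
      (∀ t ≥ (0 : ℝ), HasDerivAt u (-((u t).1) ^ 3 + Ψ ((u t).2), -((u t).2) ^ 3) t) ∧
      (∀ t ≥ (0 : ℝ), ‖u t‖ < ε) ∧ Tendsto u atTop (𝓝 0) := by
  have hR : 0 < ε / 2 := by positivity
  obtain ⟨r, hr, hΨr⟩ := Metric.continuousAt_iff.mp (hΨ.continuousAt (x := 0)) ((ε / 2) ^ 3 / 4)
    (by positivity)
  simp only [dist_zero_right, hΨ0, Real.norm_eq_abs] at hΨr
  refine ⟨min r (ε / 2), lt_min hr hR, fun ⟨x₀, y₀⟩ hz => ?_⟩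
  rw [Prod.norm_def, max_lt_iff, lt_min_iff, lt_min_iff] at hz
  simp only [Real.norm_eq_abs] at hz
  obtain ⟨⟨-, hx₀⟩, hy₀r, hy₀⟩ := hz
  set y : ℝ → ℝ := fun t => y₀ / √(1 + 2 * y₀ ^ 2 * t) with hy
  -- Reflecting time makes the forcing term bounded and continuous on the whole line.
  have hgc : Continuous fun t => Ψ (y |t|) := by
    refine hΨ.comp (continuous_const.div (by fun_prop) fun t => ?_)
    exact (Real.sqrt_pos.mpr (by positivity)).ne'
  have hg0 : Tendsto (fun t => Ψ (y |t|)) atTop (𝓝 0) := by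
    have := (hΨ.tendsto 0).comp ((tendsto_div_sqrt_atTop y₀).comp tendsto_abs_atTop_atTop)
    rwa [hΨ0] at this
  obtain ⟨x, hx0, hx, hxR, hxlim⟩ := exists_solution_neg_cube_add hgc hR
    (fun t => (hΨr ((abs_div_sqrt_le y₀ (abs_nonneg t)).trans_lt hy₀r)).le) hg0 hx₀.le
  refine ⟨fun t => (x t, y t), by simp [hx0, hy], fun t ht => ?_, fun t ht => ?_,
    hxlim.prodMk_nhds (tendsto_div_sqrt_atTop y₀)⟩
  · have h := hx t ht
    rw [abs_of_nonneg ht] at h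
    exact h.prodMk (hasDerivAt_div_sqrt_neg_cube y₀ ht)
  · rw [Prod.norm_def, max_lt_iff]
    exact ⟨(hxR t ht).trans_lt (by linarith),
      (abs_div_sqrt_le y₀ ht).trans_lt (hy₀.trans (by linarith))⟩

/-- Example 2 of the paper: if `Ψ` is locally Lipschitz, `Ψ 0 = 0` and
`|Ψ s| ≤ a |s| ^ b` for some `a > 0`, `b ≥ 1`, then the origin is an asymptotically stable
equilibrium of the planar system `ẋ₁ = −x₁³ + Ψ x₂`, `ẋ₂ = −x₂³`. -/
theorem asympStable_perturbed_cubic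
    (Ψ : ℝ → ℝ) (hΨlip : LocallyLipschitz Ψ) (hΨ0 : Ψ 0 = 0)
    (a b : ℝ) (ha : 0 < a) (hb : 1 ≤ b)
    (hΨbd : ∀ s : ℝ, |Ψ s| ≤ a * |s| ^ b) :
    -- stability of the origin :
    (∀ ε > (0 : ℝ), ∃ δ > (0 : ℝ), ∀ z₀ : ℝ × ℝ, ‖z₀‖ < δ →
      ∃ u : ℝ → ℝ × ℝ, u 0 = z₀ ∧
        (∀ t ≥ (0 : ℝ), HasDerivAt u (-((u t).1) ^ 3 + Ψ ((u t).2), -((u t).2) ^ 3) t) ∧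
        ∀ t ≥ (0 : ℝ), ‖u t‖ < ε) ∧
    -- attractivity of the origin :
    (∃ δ₀ > (0 : ℝ), ∀ z₀ : ℝ × ℝ, ‖z₀‖ < δ₀ →
      ∃ u : ℝ → ℝ × ℝ, u 0 = z₀ ∧
        (∀ t ≥ (0 : ℝ), HasDerivAt u (-((u t).1) ^ 3 + Ψ ((u t).2), -((u t).2) ^ 3) t) ∧
        Tendsto u atTop (𝓝 0)) := by
  refine ⟨fun ε hε => ?_, ?_⟩
  · obtain ⟨δ, hδ, h⟩ := exists_small_solution_tendsto_zero hΨlip.continuous hΨ0 hε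
    refine ⟨δ, hδ, fun z₀ hz₀ => ?_⟩
    obtain ⟨u, hu0, hu, hbd, -⟩ := h z₀ hz₀
    exact ⟨u, hu0, hu, hbd⟩
  · obtain ⟨δ, hδ, h⟩ := exists_small_solution_tendsto_zero hΨlip.continuous hΨ0 one_pos
    refine ⟨δ, hδ, fun z₀ hz₀ => ?_⟩
    obtain ⟨u, hu0, hu, -, hlim⟩ := h z₀ hz₀
    exact ⟨u, hu0, hu, hlim⟩
end
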